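/- Dual form of the q-binomial theorem for Macdonald polynomials: for all partitions μ, ν and parameters a, b, Σ_{λ,η} Q_{ν/η}((a−b)/(1−t)) Q_{λ/μ}((b−a)/(1−t)) P_{λ/η}(X;q,t) = P_{μ/ν}(X;q,t) · Π_{x∈X} (ax;q)_∞/(bx;q)_∞, as an identity of symmetric formal power series in the variables X, where (cx;q)_∞ = Π_{j≥0}(1−cxq^j) and the sum is over all pairs of partitions (λ,η). -/

import Mathlib

/-!
Common framework: integer partitions, Gaussian binomials, Hall--Littlewood
Pieri coefficients, the ring of symmetric functions realized as polynomials
in the power sums, the Macdonald `(q,t)`-inner product, a characterisation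
of the Macdonald polynomials `P_λ(X;q,t)`, skew Macdonald polynomials,
plethystic evaluations and the various Pieri coefficients of
Konvalinka--Lauve and Warnaar.
-/

open scoped BigOperators

noncomputable section

namespace SkewPieriFormalization

/-- An integer partition, encoded as a finitely supported weakly decreasing
sequence of natural numbers; `part j` is the part `λ_{j+1}` (0-indexed). -/
structure Partition where
  part : ℕ →₀ ℕ
  antitone' : ∀ ⦃i j : ℕ⦄, i ≤ j → part j ≤ part i

namespace Partition

/-- Containment of Young diagrams: `μ ≤ λ` iff `μ_i ≤ λ_i` for all `i`. -/
instance : LE Partition := ⟨fun mu lam => ∀ j : ℕ, mu.part j ≤ lam.part j⟩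

/-- `|λ|`, the size (sum of the parts). -/
def size (lam : Partition) : ℕ := lam.part.sum fun _ k => k

/-- `l(λ)`, the number of (nonzero) parts. -/
def length (lam : Partition) : ℕ := lam.part.support.card

/-- `n(λ) = ∑_{i ≥ 1} (i-1) λ_i`. -/
def nstat (lam : Partition) : ℕ := lam.part.sum fun j k => j * k

/-- the `i`-th part `λ_i` (1-indexed). -/
def row (lam : Partition) (i : ℕ) : ℕ := lam.part (i - 1)

/-- the part `λ'_i = #{j : λ_j ≥ i}` of the conjugate partition (for `i ≥ 1`). -/
def conj (lam : Partition) (i : ℕ) : ℕ :=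
  (lam.part.support.filter fun j => i ≤ lam.part j).card

/-- the multiplicity `m_r(λ)` of `r` as a part of `λ`. -/
def mult (lam : Partition) (r : ℕ) : ℕ :=
  (lam.part.support.filter fun j => lam.part j = r).card

/-- `z_λ = ∏_{r ≥ 1} r^{m_r} m_r!`. -/
def zee (lam : Partition) : ℕ :=
  ∏ r ∈ Finset.Icc 1 (lam.part 0), r ^ lam.mult r * Nat.factorial (lam.mult r)

/-- the partial sum `λ_1 + ⋯ + λ_k`. -/
def psum (lam : Partition) (k : ℕ) : ℕ := ∑ j ∈ Finset.range k, lam.part j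

/-- dominance order: `λ ⊵ μ` (for `|λ| = |μ|`). -/
def Dominates (lam mu : Partition) : Prop :=
  mu.size = lam.size ∧ ∀ k : ℕ, mu.psum k ≤ lam.psum k

/-- the one-row partition `(r)`. -/
def single (r : ℕ) : Partition where
  part := Finsupp.single 0 r
  antitone' := by
    intro i j hij
    by_cases hj : j = 0
    · have : i = 0 := by omega
      simp [hj, this]
    · simp only [Finsupp.single_apply]
      split <;> split <;> omega

/-- the one-column partition `(1^m)`. -/
def column (m : ℕ) : Partition where
  part := Finsupp.onFinset (Finset.range m) (fun j => if j < m then 1 else 0)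
    (fun j h => by
      simp only [Finset.mem_range]
      by_contra hc
      simp [hc] at h)
  antitone' := by
    intro i j hij
    simp only [Finsupp.onFinset_apply]
    split <;> split <;> omega

end Partition

variable {F : Type*} [Field F]

/-- the `t`-integer `[n]_t = 1 + t + ⋯ + t^{n-1}`. -/
def qint (t : F) (n : ℕ) : F := ∑ j ∈ Finset.range n, t ^ j

/-- the `t`-factorial. -/
def qfac (t : F) (n : ℕ) : F := ∏ j ∈ Finset.range n, qint t (j + 1)

/-- the Gaussian binomial coefficient `[n choose k]_t`; it vanishes
unless `0 ≤ k ≤ n`. -/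
def qbinom (t : F) (n k : ℤ) : F :=
  if 0 ≤ k ∧ k ≤ n then qfac t n.toNat / (qfac t k.toNat * qfac t (n - k).toNat) else 0

/-- the Hall--Littlewood Pieri coefficient
`ψ'_{λ/μ}(t) = ∏_{i ≥ 1} [λ'_i - λ'_{i+1} choose λ'_i - μ'_i]_t`;
it vanishes unless `μ ⊆ λ` with `λ - μ` a vertical strip. -/
def vsHL (t : F) (lam mu : Partition) : F :=
  ∏ i ∈ Finset.Icc 1 (lam.part 0 + mu.part 0),
    qbinom t ((lam.conj i : ℤ) - lam.conj (i + 1)) ((lam.conj i : ℤ) - mu.conj i)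

open Classical in
/-- the Hall--Littlewood Pieri coefficient `φ_{λ/μ}(t)`, equal to
`∏ (1 - t^{λ'_i - λ'_{i+1}})` over those `i ≥ 1` with `λ'_i = μ'_i + 1` and
`λ'_{i+1} = μ'_{i+1}`, when `μ ⊆ λ` with `λ - μ` a horizontal strip, and
vanishing otherwise. -/
def hsHL (t : F) (lam mu : Partition) : F :=
  if ∀ i : ℕ, mu.conj i ≤ lam.conj i ∧ lam.conj i ≤ mu.conj i + 1 then
    ∏ i ∈ Finset.Icc 1 (lam.part 0 + mu.part 0),
      if lam.conj i = mu.conj i + 1 ∧ lam.conj (i + 1) = mu.conj (i + 1) then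
        1 - t ^ (lam.conj i - lam.conj (i + 1))
      else 1
  else 0

/-- `n(λ/μ) = ∑_{i ≥ 1} C(λ'_i - μ'_i, 2)`. -/
def nskew (lam mu : Partition) : ℕ :=
  ∑ i ∈ Finset.Icc 1 (lam.part 0 + mu.part 0), Nat.choose (lam.conj i - mu.conj i) 2

/-- the Konvalinka--Lauve coefficient
`sk_{λ/μ}(t) = t^{n(λ/μ)} ∏_{i ≥ 1} [λ'_i - μ'_{i+1} choose λ'_i - μ'_i]_t`;
it vanishes unless `μ ⊆ λ`. -/
def skHL (t : F) (lam mu : Partition) : F :=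
  t ^ nskew lam mu *
    ∏ i ∈ Finset.Icc 1 (lam.part 0 + mu.part 0),
      qbinom t ((lam.conj i : ℤ) - mu.conj (i + 1)) ((lam.conj i : ℤ) - mu.conj i)

/-- The ring of symmetric functions over `F`, realized as the polynomial ring
in the power sums: the variable `n` is the power sum `p_{n+1}`. -/
abbrev Sym (F : Type*) [Field F] := MvPolynomial ℕ F

/-- the power sum product `p_λ = p_{λ_1} p_{λ_2} ⋯`. -/
def pprod (lam : Partition) : Sym F :=
  ∏ j ∈ lam.part.support, MvPolynomial.X (lam.part j - 1)

/-- Macdonald's `(q,t)`-deformation of the Hall inner product, for which the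
power sums are orthogonal with `⟨p_λ, p_λ⟩ = z_λ ∏_i (1-q^{λ_i})/(1-t^{λ_i})`. -/
def innerQT (q t : F) (f g : Sym F) : F :=
  ∑ d ∈ f.support,
    f.coeff d * g.coeff d *
      d.prod fun n m =>
        (((n : F) + 1) ^ m * (Nat.factorial m : F)) *
          ((1 - q ^ (n + 1)) / (1 - t ^ (n + 1))) ^ m

/-- the complete homogeneous symmetric function `h_r = ∑_{|κ| = r} z_κ⁻¹ p_κ`. -/
def hsym (F : Type*) [Field F] (r : ℕ) : Sym F :=
  ∑ᶠ (k : Partition) (_ : k.size = r), ((k.zee : F))⁻¹ • (pprod k : Sym F)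

/-- the elementary symmetric function `e_r = ∑_{|κ| = r} (-1)^{r - l(κ)} z_κ⁻¹ p_κ`. -/
def esym (F : Type*) [Field F] (r : ℕ) : Sym F :=
  ∑ᶠ (k : Partition) (_ : k.size = r),
    ((-1 : F) ^ (r - k.length) * (k.zee : F)⁻¹) • (pprod k : Sym F)

/-- `h_μ = h_{μ_1} h_{μ_2} ⋯`. -/
def hprod (F : Type*) [Field F] (mu : Partition) : Sym F :=
  ∏ j ∈ mu.part.support, hsym F (mu.part j)

/-- Characterisation of the (monic) Macdonald polynomial family
`λ ↦ P_λ(X;q,t)`: the `P_λ` are pairwise orthogonal for the `(q,t)`-inner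
product, and `P_λ = m_λ + ∑_{μ ⊲ λ} u_{λμ} m_μ` is unitriangular with respect
to dominance order in the monomial basis.  Since `{h_μ}` is the dual basis of
`{m_μ}` for the classical Hall pairing (the case `q = t`), unitriangularity is
expressed by the last two conditions.  For `q = 0` this characterises the
Hall--Littlewood polynomials `P_λ(X;t)`. -/
def IsMacdonald (q t : F) (P : Partition → Sym F) : Prop :=
  (∀ lam mu, lam ≠ mu → innerQT q t (P lam) (P mu) = 0) ∧
  (∀ lam, innerQT t t (P lam) (hprod F lam) = 1) ∧
  (∀ lam mu, ¬ Partition.Dominates lam mu → innerQT t t (P lam) (hprod F mu) = 0)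

/-- `b_λ = ⟨P_λ, P_λ⟩⁻¹`. -/
def bnorm (q t : F) (P : Partition → Sym F) (lam : Partition) : F :=
  (innerQT q t (P lam) (P lam))⁻¹

/-- `Q_λ = b_λ P_λ`. -/
def macQ (q t : F) (P : Partition → Sym F) (lam : Partition) : Sym F :=
  bnorm q t P lam • P lam

/-- the skew Macdonald polynomial `Q_{λ/μ}`, defined by
`⟨Q_{λ/μ}, P_ν⟩ = ⟨Q_λ, P_μ P_ν⟩`. -/
def skewQ (q t : F) (P : Partition → Sym F) (lam mu : Partition) : Sym F :=
  ∑ᶠ nu : Partition, innerQT q t (macQ q t P lam) (P mu * P nu) • macQ q t P nu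

/-- the skew Macdonald polynomial `P_{λ/μ}`, defined by
`⟨P_{λ/μ}, Q_ν⟩ = ⟨P_λ, Q_μ Q_ν⟩`. -/
def skewP (q t : F) (P : Partition → Sym F) (lam mu : Partition) : Sym F :=
  ∑ᶠ nu : Partition, innerQT q t (P lam) (macQ q t P mu * macQ q t P nu) • P nu

/-- the Littlewood--Richardson coefficient `f_{μν}^λ(q,t) = ⟨Q_λ, P_μ P_ν⟩`,
so that `P_μ P_ν = ∑_λ f_{μν}^λ P_λ`. -/
def lr (q t : F) (P : Partition → Sym F) (mu nu lam : Partition) : F :=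
  innerQT q t (macQ q t P lam) (P mu * P nu)

/-- the plethystic evaluation `f ↦ f((a-b)/(1-t))`, determined on power sums
by `p_r ↦ (a^r - b^r)/(1 - t^r)`. -/
def plethAB (t a b : F) (f : Sym F) : F :=
  MvPolynomial.eval (fun n => (a ^ (n + 1) - b ^ (n + 1)) / (1 - t ^ (n + 1))) f

/-- `vs_{λ/μ}(q,t) = ψ'_{λ/μ}(q,t) = (-1)^{|λ|-|μ|} Q_{λ/μ}((q-1)/(1-t))`. -/
def vsM (q t : F) (P : Partition → Sym F) (lam mu : Partition) : F :=
  (-1 : F) ^ ((lam.size : ℤ) - (mu.size : ℤ)) * plethAB t q 1 (skewQ q t P lam mu)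

/-- `sk_{λ/μ}(q,t) = Q_{λ/μ}((1-q)/(1-t))`. -/
def skM (q t : F) (P : Partition → Sym F) (lam mu : Partition) : F :=
  plethAB t 1 q (skewQ q t P lam mu)

/-- `ŝk_{λ/μ}(q,t) = Q_{λ/μ}((1-q/t)/(1-t))`. -/
def skHatM (q t : F) (P : Partition → Sym F) (lam mu : Partition) : F :=
  plethAB t 1 (q / t) (skewQ q t P lam mu)

/-- `hs_{λ/μ}(q,t) = φ_{λ/μ}(q,t) = Q_{λ/μ}(1)`, the plethystic evaluation
`p_r ↦ 1`. -/
def hsM (q t : F) (P : Partition → Sym F) (lam mu : Partition) : F :=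
  MvPolynomial.eval (fun _ => (1 : F)) (skewQ q t P lam mu)

/-- `ks_{λ/μ}(q,t) = Q_{λ/μ}(-1)`, the plethystic evaluation `p_r ↦ -1`. -/
def ksM (q t : F) (P : Partition → Sym F) (lam mu : Partition) : F :=
  MvPolynomial.eval (fun _ => (-1 : F)) (skewQ q t P lam mu)

/-- the finite `q`-Pochhammer symbol `(a;q)_k = ∏_{j=0}^{k-1}(1 - a q^j)`. -/
def qPochN (qq a : F) (k : ℕ) : F := ∏ j ∈ Finset.range k, (1 - a * qq ^ j)

/-- the `q`-Pochhammer symbol `(a;q)_k = (a;q)_∞/(a q^k;q)_∞` for `k ∈ ℤ`;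
for `k = -m < 0` it equals `1/∏_{i=1}^m (1 - a q^{-i})`. -/
def qPochZ (qq a : F) (k : ℤ) : F :=
  if 0 ≤ k then qPochN qq a k.toNat
  else (∏ j ∈ Finset.range (-k).toNat, (1 - a * (qq⁻¹) ^ (j + 1)))⁻¹

/-- `(a)_λ = (a;q,t)_λ = ∏_{i ≥ 1} (a t^{1-i}; q)_{λ_i}`. -/
def qtPoch (qq tt a : F) (lam : Partition) : F :=
  ∏ j ∈ lam.part.support, qPochN qq (a * tt ^ (-(j : ℤ))) (lam.part j)

/-- the degree (as a symmetric function) of a power-sum exponent vector. -/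
def wt (d : ℕ →₀ ℕ) : ℕ := d.sum fun n m => (n + 1) * m

/-- the degree-`r` homogeneous component of `∏_x (bx;q)_∞/(ax;q)_∞`, namely
`∑_{|κ| = r} z_κ⁻¹ ∏_i (a^{κ_i} - b^{κ_i})/(1 - q^{κ_i}) · p_κ`. -/
def prodComp (a b qq : F) (r : ℕ) : Sym F :=
  ∑ᶠ (k : Partition) (_ : k.size = r),
    ((k.zee : F)⁻¹ *
        ∏ j ∈ k.part.support,
          (a ^ k.part j - b ^ k.part j) / (1 - qq ^ k.part j)) • (pprod k : Sym F)

/-- `∏_x (bx;q)_∞/(ax;q)_∞`, where `(cx;q)_∞ = ∏_{j ≥ 0}(1 - cx q^j)`, as a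
formal power series in the power sums. -/
def prodSeries (a b qq : F) : MvPowerSeries ℕ F :=
  fun d => MvPolynomial.coeff d (prodComp a b qq (wt d))

/-- the formal (possibly infinite) sum `∑_i c_i g_i` of symmetric functions,
as a formal power series in the power sums. -/
def sumSeries {ι : Type*} (c : ι → F) (g : ι → Sym F) : MvPowerSeries ℕ F :=
  fun d => ∑ᶠ i : ι, c i * MvPolynomial.coeff d (g i)

/-- `ℚ(t)` -/
abbrev F1 : Type := RatFunc ℚ
/-- `ℚ(t)(q)` -/
abbrev F2 : Type := RatFunc F1
/-- `ℚ(t)(q)(a)` -/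
abbrev F3 : Type := RatFunc F2
/-- `ℚ(t)(q)(a)(b)` -/
abbrev F4 : Type := RatFunc F3

instance : Field F2 := inferInstance
instance : Field F3 := inferInstance
instance : Field F4 := inferInstance

/-- the indeterminate `t` in `ℚ(t)`. -/
def t1 : F1 := RatFunc.X
/-- the indeterminate `q` in `ℚ(t)(q)`. -/
def q2 : F2 := RatFunc.X
/-- the indeterminate `t` in `ℚ(t)(q)`. -/
def t2 : F2 := RatFunc.C t1
/-- the indeterminate `a` in `ℚ(t)(q)(a)`. -/
def a3 : F3 := RatFunc.X
/-- the indeterminate `q` in `ℚ(t)(q)(a)`. -/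
def q3 : F3 := RatFunc.C q2
/-- the indeterminate `t` in `ℚ(t)(q)(a)`. -/
def t3 : F3 := RatFunc.C t2
/-- the indeterminate `b` in `ℚ(t)(q)(a)(b)`. -/
def b4 : F4 := RatFunc.X
/-- the indeterminate `a` in `ℚ(t)(q)(a)(b)`. -/
def a4 : F4 := RatFunc.C a3
/-- the indeterminate `q` in `ℚ(t)(q)(a)(b)`. -/
def q4 : F4 := RatFunc.C q3
/-- the indeterminate `t` in `ℚ(t)(q)(a)(b)`. -/
def t4 : F4 := RatFunc.C t3


/-! ### Partitions versus exponent vectors -/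

/-- The exponent vector of the power sum product attached to a partition. -/
def expo (k : Partition) : ℕ →₀ ℕ :=
  ∑ j ∈ k.part.support, Finsupp.single (k.part j - 1) 1

theorem expo_apply (k : Partition) (n : ℕ) : expo k n = k.mult (n + 1) := by
  unfold expo Partition.mult
  rw [Finsupp.finsetSum_apply, Finset.card_filter]
  refine Finset.sum_congr rfl fun j hj => ?_
  have : k.part j ≠ 0 := by simpa using hj
  rw [Finsupp.single_apply]
  congr 1
  apply propext
  omega

theorem expo_prod {M : Type*} [CommMonoid M] (k : Partition) (g : ℕ → M) :
    (expo k).prod (fun n m => g n ^ m) = ∏ j ∈ k.part.support, g (k.part j - 1) := by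
  unfold expo
  rw [← Finsupp.prod_finsetSum_index]
  · refine Finset.prod_congr rfl fun j _ => ?_
    rw [Finsupp.prod_single_index] <;> simp
  · intro; simp
  · intro a b c; exact pow_add _ _ _

theorem wt_add (d e : ℕ →₀ ℕ) : wt (d + e) = wt d + wt e := by
  unfold wt
  rw [Finsupp.sum_add_index'] <;> intros <;> ring

theorem wt_single (n m : ℕ) : wt (Finsupp.single n m) = (n + 1) * m := by
  unfold wt
  rw [Finsupp.sum_single_index]; simp

theorem wt_zero : wt 0 = 0 := by simp [wt]

theorem wt_expo (k : Partition) : wt (expo k) = k.size := by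
  unfold expo Partition.size Finsupp.sum
  have h : ∀ s : Finset ℕ, wt (∑ j ∈ s, Finsupp.single (k.part j - 1) 1) =
      ∑ j ∈ s, (k.part j - 1 + 1) := by
    intro s
    induction s using Finset.cons_induction with
    | empty => simp [wt_zero]
    | cons a s ha ih => rw [Finset.sum_cons, Finset.sum_cons, wt_add, ih, wt_single]; simp
  rw [h]
  refine Finset.sum_congr rfl fun j hj => ?_
  have : k.part j ≠ 0 := by simpa using hj
  change k.part j - 1 + 1 = k.part j
  omega

theorem lower_eq_range (S : Finset ℕ) (h : ∀ i ∈ S, ∀ j ≤ i, j ∈ S) :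
    S = Finset.range S.card := by
  apply Finset.eq_of_subset_of_card_le
  · intro i hi
    have : Finset.range (i + 1) ⊆ S := fun j hj => h i hi j (by simp at hj; omega)
    have := Finset.card_le_card this
    simp at this ⊢; omega
  · simp

theorem Partition.ext_part {k l : Partition} (h : ∀ j, k.part j = l.part j) : k = l := by
  cases k; cases l; congr; exact Finsupp.ext h

theorem conj_iff (k : Partition) (i j : ℕ) (hi : 1 ≤ i) : i ≤ k.part j ↔ j < k.conj i := by
  have h := lower_eq_range (k.part.support.filter fun j => i ≤ k.part j) (by
    intro a ha b hb
    have := k.antitone' hb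
    simp at ha ⊢
    omega)
  have h2 : j ∈ (k.part.support.filter fun j => i ≤ k.part j) ↔ j < k.conj i := by
    rw [h]; simp [Partition.conj]
  rw [← h2]; simp; omega

theorem conj_eq (k : Partition) (i : ℕ) :
    k.conj i = (expo k).sum (fun n m => if i ≤ n + 1 then m else 0) := by
  unfold expo Partition.conj
  rw [← Finsupp.sum_finsetSum_index, Finset.card_filter]
  · refine Finset.sum_congr rfl fun j hj => ?_
    have : k.part j ≠ 0 := by simpa using hj
    rw [Finsupp.sum_single_index (by simp)]
    congr 1
    apply propext; omega
  · simp
  · intros; split <;> simp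

theorem expo_injective : Function.Injective expo := by
  intro k l h
  apply Partition.ext_part
  intro j
  have key : ∀ i, 1 ≤ i → (i ≤ k.part j ↔ i ≤ l.part j) := by
    intro i hi
    rw [conj_iff k i j hi, conj_iff l i j hi, conj_eq k i, conj_eq l i, h]
  have h1 := key (k.part j)
  have h2 := key (l.part j)
  omega

theorem expo_surjective : Function.Surjective expo := by
  intro d
  let l : List ℕ := ((Finsupp.toMultiset d).map (· + 1)).sort (· ≥ ·)
  have hl : (l : Multiset ℕ) = (Finsupp.toMultiset d).map (· + 1) := Multiset.sort_eq _ _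
  have hsort : l.Pairwise (· ≥ ·) := Multiset.pairwise_sort _ _
  have hpos : ∀ x ∈ l, x ≠ 0 := by
    intro x hx
    have : x ∈ (l : Multiset ℕ) := hx
    rw [hl] at this
    simp at this
    obtain ⟨a, _, rfl⟩ := this
    omega
  let p : ℕ →₀ ℕ := Finsupp.onFinset (Finset.range l.length) (fun j => l.getD j 0) (by
    intro j hj
    simp only [Finset.mem_range]
    by_contra hc
    exact hj (List.getD_eq_default _ _ (by omega)))
  have hp : ∀ j, p j = l.getD j 0 := fun j => rfl
  let k : Partition := ⟨p, by
    intro i j hij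
    rw [hp, hp]
    by_cases hj : j < l.length
    · rw [List.getD_eq_getElem _ _ hj, List.getD_eq_getElem _ _ (by omega)]
      rcases hij.eq_or_lt with h | h
      · subst h; exact le_refl _
      · exact List.pairwise_iff_getElem.1 hsort i j (by omega) hj h
    · rw [List.getD_eq_default l 0 (by omega)]; simp⟩
  have hsupp : p.support = Finset.range l.length := by
    ext j
    simp only [Finsupp.mem_support_iff, Finset.mem_range, hp]
    by_cases hj : j < l.length
    · rw [List.getD_eq_getElem _ _ hj]
      simp [hj, hpos]
    · rw [List.getD_eq_default l 0 (by omega)]; simp [hj]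
  refine ⟨k, ?_⟩
  ext n
  rw [expo_apply]
  unfold Partition.mult
  change (Finset.filter (fun j => p j = n + 1) p.support).card = _
  have h1 : (Finset.filter (fun j => p j = n + 1) p.support).card = List.count (n+1) l := by
    rw [hsupp]
    have : l = (List.range l.length).map (fun j => l.getD j 0) := by
      apply List.ext_getElem
      · simp
      · intro i h1 h2
        simp [List.getElem?_eq_getElem h1]
    conv_rhs => rw [this]
    rw [List.count, List.countP_map, Finset.card, Finset.filter_val, ← Multiset.countP_eq_card_filter]
    change Multiset.countP _ (Multiset.range _) = _
    rw [Multiset.range, Multiset.coe_countP]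
    congr 1
  rw [h1, ← Multiset.coe_count, hl, Multiset.count_map_eq_count' _ _ (add_left_injective 1)]
  simp

/-- partitions are the same as exponent vectors of power sum monomials -/
def expoEquiv : Partition ≃ (ℕ →₀ ℕ) := Equiv.ofBijective expo ⟨expo_injective, expo_surjective⟩

theorem expoEquiv_apply (k : Partition) : expoEquiv k = expo k := rfl

theorem pprod_eq (k : Partition) : (pprod k : Sym F) = MvPolynomial.monomial (expo k) 1 := by
  unfold pprod
  rw [← expo_prod k (fun n => (MvPolynomial.X n : Sym F)), MvPolynomial.monomial_eq]
  simp

theorem zee_eq (k : Partition) :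
    (k.zee : F) = (expo k).prod fun n m => ((n : F) + 1) ^ m * (Nat.factorial m : F) := by
  unfold Partition.zee
  rw [Finsupp.prod_of_support_subset (s := Finset.range (k.part 0))]
  · push_cast
    rw [Finset.range_eq_Ico]
    rw [show Finset.Icc 1 (k.part 0) = (Finset.Ico 0 (k.part 0)).map (addRightEmbedding 1) by
      ext x; simp
      constructor
      · intro h; exact ⟨x - 1, by omega, by omega⟩
      · rintro ⟨a, ha, rfl⟩; omega]
    simp [expo_apply]
  · intro n hn
    rw [Finsupp.mem_support_iff, expo_apply] at hn
    unfold Partition.mult at hn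
    rw [Finset.card_ne_zero] at hn
    obtain ⟨j, hj⟩ := hn
    simp at hj
    have := k.antitone' (Nat.zero_le j)
    simp; omega
  · simp

theorem le_wt (d : ℕ →₀ ℕ) (i : ℕ) : (i + 1) * d i ≤ wt d := by
  by_cases h : i ∈ d.support
  · exact Finset.single_le_sum (f := fun n => (n + 1) * d n) (fun _ _ => Nat.zero_le _) h
  · have : d i = 0 := by simpa using h
    simp [this]

theorem wt_finite (n : ℕ) : {d : ℕ →₀ ℕ | wt d = n}.Finite := by
  apply Set.Finite.subset (Finset.finite_toSet
    ((Finset.range n).finsupp (fun _ => Finset.range (n + 1))))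
  intro d hd
  have hd : wt d = n := hd
  rw [Finset.mem_coe, Finset.mem_finsupp_iff]
  constructor
  · intro i hi
    have h1 := le_wt d i
    have h2 : 1 ≤ d i := Nat.one_le_iff_ne_zero.2 (by simpa using hi)
    simp only [Finset.mem_range]
    nlinarith
  · intro i _
    have h1 := le_wt d i
    simp only [Finset.mem_range]
    nlinarith

theorem size_finite (n : ℕ) : {k : Partition | k.size = n}.Finite := by
  have := (wt_finite n).preimage (expo_injective.injOn)
  refine this.subset ?_
  intro k hk
  change wt (expo k) = n
  rw [wt_expo]; exact hk

/-- the finite set of partitions of `n` -/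
def sizeFin (n : ℕ) : Finset Partition := (size_finite n).toFinset

theorem finsum_size {M : Type*} [AddCommMonoid M] (n : ℕ) (c : Partition → M) :
    ∑ᶠ (k : Partition) (_ : k.size = n), c k = ∑ k ∈ sizeFin n, c k :=
  finsum_mem_eq_finite_toFinset_sum c (size_finite n)

/-! ### The pairing -/

/-- the norm of a power sum monomial -/
def ww (q t : F) (d : ℕ →₀ ℕ) : F :=
  d.prod fun n m =>
    (((n : F) + 1) ^ m * (Nat.factorial m : F)) * ((1 - q ^ (n + 1)) / (1 - t ^ (n + 1))) ^ m

/-- the norm of `p_{n+1}` -/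
def cc (q t : F) (n : ℕ) : F := ((n : F) + 1) * ((1 - q ^ (n + 1)) / (1 - t ^ (n + 1)))

theorem ww_zero (q t : F) : ww q t 0 = 1 := by simp [ww]

theorem ww_add_single (q t : F) (e : ℕ →₀ ℕ) (n : ℕ) :
    ww q t (e + Finsupp.single n 1) = ww q t e * (cc q t n * ((e n : F) + 1)) := by
  unfold ww
  rw [← Finsupp.mul_prod_erase' (e + Finsupp.single n 1) n _ (by simp),
    ← Finsupp.mul_prod_erase' e n _ (by simp)]
  have h : Finsupp.erase n (e + Finsupp.single n 1) = Finsupp.erase n e := by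
    rw [Finsupp.erase_add, Finsupp.erase_single, add_zero]
  rw [h]
  simp only [Finsupp.add_apply, Finsupp.single_eq_same, Nat.factorial_succ, cc]
  push_cast
  ring

/-- pairing of a power series with a polynomial -/
def pairing (q t : F) (G : MvPowerSeries ℕ F) : Sym F →ₗ[F] F :=
  (MvPolynomial.basisMonomials ℕ F).constr F (fun d => MvPowerSeries.coeff d G * ww q t d)

theorem pairing_monomial (q t : F) (G : MvPowerSeries ℕ F) (d : ℕ →₀ ℕ) (c : F) :
    pairing q t G (MvPolynomial.monomial d c) = c * (MvPowerSeries.coeff d G * ww q t d) := by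
  have h : (MvPolynomial.monomial d c : Sym F) = c • MvPolynomial.basisMonomials ℕ F d := by
    rw [MvPolynomial.coe_basisMonomials, MvPolynomial.smul_monomial, smul_eq_mul, mul_one]
  rw [h, map_smul]
  unfold pairing
  rw [Module.Basis.constr_basis, smul_eq_mul]

theorem pairing_add (q t : F) (G H : MvPowerSeries ℕ F) (f : Sym F) :
    pairing q t (G + H) f = pairing q t G f + pairing q t H f := by
  induction f using MvPolynomial.induction_on' with
  | monomial d a => simp only [pairing_monomial, map_add]; ring
  | add p q hp hq => simp only [map_add, hp, hq]; ring

theorem pairing_smul (q t : F) (c : F) (G : MvPowerSeries ℕ F) (f : Sym F) :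
    pairing q t (c • G) f = c * pairing q t G f := by
  induction f using MvPolynomial.induction_on' with
  | monomial d a => simp only [pairing_monomial, map_smul, smul_eq_mul]; ring
  | add p q hp hq => simp only [map_add, hp, hq]; ring

theorem pairing_X_mul (q t : F) (n : ℕ) (G : MvPowerSeries ℕ F) (f : Sym F) :
    pairing q t (MvPowerSeries.X n * G) f = cc q t n * pairing q t G (MvPolynomial.pderiv n f) := by
  induction f using MvPolynomial.induction_on' with
  | monomial d a =>
    rw [MvPolynomial.pderiv_monomial, pairing_monomial, pairing_monomial]
    by_cases h : d n = 0
    · have : MvPowerSeries.coeff d (MvPowerSeries.X n * G) = 0 := by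
        rw [MvPowerSeries.X, MvPowerSeries.coeff_monomial_mul, if_neg]
        intro hle
        have := hle n
        simp [h] at this
      rw [this, h]; simp
    · obtain ⟨e, rfl⟩ : ∃ e : ℕ →₀ ℕ, d = e + Finsupp.single n 1 := by
        refine ⟨d - Finsupp.single n 1, ?_⟩
        rw [tsub_add_cancel_of_le]
        intro m
        rw [Finsupp.single_apply]
        split
        · subst_vars; omega
        · omega
      rw [add_tsub_cancel_right, ww_add_single, add_comm e, MvPowerSeries.X,
        MvPowerSeries.coeff_add_monomial_mul]
      simp only [Finsupp.add_apply, Finsupp.single_eq_same]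
      push_cast
      ring
  | add p q hp hq => simp only [map_add, hp, hq]; ring

/-- the inner product as a bilinear form -/
def BB (q t : F) : Sym F →ₗ[F] Sym F →ₗ[F] F where
  toFun f := pairing q t (f : MvPowerSeries ℕ F)
  map_add' f g := by
    apply LinearMap.ext
    intro h
    rw [MvPolynomial.coe_add, LinearMap.add_apply, pairing_add]
  map_smul' c f := by
    apply LinearMap.ext
    intro h
    rw [MvPolynomial.coe_smul, pairing_smul]
    rfl

theorem BB_apply (q t : F) (f g : Sym F) :
    BB q t f g = pairing q t (f : MvPowerSeries ℕ F) g := rfl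

theorem BB_monomial (q t : F) (f : Sym F) (d : ℕ →₀ ℕ) (c : F) :
    BB q t f (MvPolynomial.monomial d c) = c * (MvPolynomial.coeff d f * ww q t d) := by
  rw [BB_apply, pairing_monomial, MvPolynomial.coeff_coe]

theorem BB_symm (q t : F) (f g : Sym F) : BB q t f g = BB q t g f := by
  induction f using MvPolynomial.induction_on' with
  | monomial d a =>
    induction g using MvPolynomial.induction_on' with
    | monomial e b =>
      rw [BB_monomial, BB_monomial, MvPolynomial.coeff_monomial, MvPolynomial.coeff_monomial]
      by_cases h : d = e
      · subst h; simp; ring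
      · rw [if_neg h, if_neg (Ne.symm h)]; simp
    | add p q hp hq => simp only [map_add, hp, hq, LinearMap.add_apply]
  | add p q hp hq => simp only [map_add, hp, hq, LinearMap.add_apply]

theorem innerQT_eq (q t : F) (f g : Sym F) : innerQT q t f g = BB q t f g := by
  rw [BB_symm]
  conv_rhs => rw [f.as_sum]
  rw [map_sum]
  unfold innerQT
  refine Finset.sum_congr rfl fun d _ => ?_
  rw [BB_monomial, mul_assoc]
  rfl

theorem BB_X_mul (q t : F) (n : ℕ) (f g : Sym F) :
    BB q t (MvPolynomial.X n * f) g = BB q t f (cc q t n • MvPolynomial.pderiv n g) := by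
  rw [BB_apply, MvPolynomial.coe_mul, MvPolynomial.coe_X, pairing_X_mul, map_smul]
  rfl

theorem BB_C (q t : F) (c : F) (g : Sym F) :
    BB q t (MvPolynomial.C c) g = c * MvPolynomial.constantCoeff g := by
  rw [BB_symm, MvPolynomial.C_apply, BB_monomial, ww_zero, mul_one]
  rfl

theorem ww_ne_zero [CharZero F] {q t : F} (hq : ∀ n : ℕ, 1 - q ^ (n + 1) ≠ 0)
    (ht : ∀ n : ℕ, 1 - t ^ (n + 1) ≠ 0) (d : ℕ →₀ ℕ) : ww q t d ≠ 0 := by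
  unfold ww Finsupp.prod
  rw [Finset.prod_ne_zero_iff]
  intro n _
  have h1 : (n : F) + 1 ≠ 0 := Nat.cast_add_one_ne_zero n
  have h2 : ((d n).factorial : F) ≠ 0 := Nat.cast_ne_zero.2 (Nat.factorial_ne_zero _)
  exact mul_ne_zero (mul_ne_zero (pow_ne_zero _ h1) h2)
    (pow_ne_zero _ (div_ne_zero (hq n) (ht n)))

theorem BB_nondeg [CharZero F] {q t : F} (hq : ∀ n : ℕ, 1 - q ^ (n + 1) ≠ 0)
    (ht : ∀ n : ℕ, 1 - t ^ (n + 1) ≠ 0) (f g : Sym F)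
    (h : ∀ d, BB q t f (MvPolynomial.monomial d 1) = BB q t g (MvPolynomial.monomial d 1)) :
    f = g := by
  ext d
  have := h d
  rw [BB_monomial, BB_monomial, one_mul, one_mul] at this
  exact mul_right_cancel₀ (ww_ne_zero hq ht d) this

/-- the translation `p_r ↦ p_r + φ(p_r)` -/
def TT (φ : ℕ → F) : Sym F →ₐ[F] Sym F :=
  MvPolynomial.aeval fun n => MvPolynomial.X n + MvPolynomial.C (φ n)

theorem pderiv_TT (φ : ℕ → F) (n : ℕ) (f : Sym F) :
    MvPolynomial.pderiv n (TT φ f) = TT φ (MvPolynomial.pderiv n f) := by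
  induction f using MvPolynomial.induction_on with
  | C a => simp [TT]
  | add p q hp hq => simp only [map_add, hp, hq]
  | mul_X p m hp =>
    have hX : TT φ (MvPolynomial.X m) = MvPolynomial.X m + MvPolynomial.C (φ m) := by simp [TT]
    rw [map_mul, Derivation.leibniz, Derivation.leibniz, hp, hX]
    simp only [map_add, smul_eq_mul, map_mul, hX, MvPolynomial.pderiv_C, add_zero]
    congr 2
    simp only [MvPolynomial.pderiv_X]
    by_cases h : n = m
    · subst h; simp
    · simp [h]

theorem constantCoeff_TT (φ : ℕ → F) (f : Sym F) :
    MvPolynomial.constantCoeff (TT φ f) = MvPolynomial.eval φ f := by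
  induction f using MvPolynomial.induction_on with
  | C a => simp [TT]
  | add p q hp hq => simp only [map_add, hp, hq]
  | mul_X p m hp => rw [map_mul, map_mul, hp]; simp [TT]

theorem TT_inv (φ ψ : ℕ → F) (h : ∀ n, φ n + ψ n = 0) (f : Sym F) : TT ψ (TT φ f) = f := by
  have : (TT ψ).comp (TT φ) = AlgHom.id F _ := by
    apply MvPolynomial.algHom_ext
    intro n
    simp only [TT, AlgHom.comp_apply, MvPolynomial.aeval_X, map_add, MvPolynomial.aeval_C,
      AlgHom.id_apply, MvPolynomial.algebraMap_eq]
    rw [add_assoc, ← map_add, add_comm (ψ n), h]; simp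
  exact DFunLike.congr_fun this f

/-- existence of adjoints of multiplication operators -/
theorem exists_adj (q t : F) (φ : ℕ → F) (g : Sym F) : ∀ f : Sym F, ∃ S : Sym F,
    (∀ h, BB q t S h = BB q t f (g * h)) ∧ MvPolynomial.eval φ S = BB q t g (TT φ f) := by
  induction g using MvPolynomial.induction_on with
  | C a =>
    intro f
    refine ⟨a • f, fun h => ?_, ?_⟩
    · rw [← MvPolynomial.smul_eq_C_mul]; simp
    · rw [BB_C, constantCoeff_TT]; simp
  | add p r hp hr =>
    intro f
    obtain ⟨S, h1, h2⟩ := hp f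
    obtain ⟨S', h1', h2'⟩ := hr f
    refine ⟨S + S', fun h => ?_, ?_⟩
    · rw [add_mul, map_add, map_add, LinearMap.add_apply, h1, h1']
    · rw [map_add, map_add, LinearMap.add_apply, h2, h2']
  | mul_X p n hp =>
    intro f
    obtain ⟨S, h1, h2⟩ := hp (cc q t n • MvPolynomial.pderiv n f)
    refine ⟨S, fun h => ?_, ?_⟩
    · rw [h1, BB_symm, ← BB_X_mul, BB_symm]
      congr 1; ring
    · rw [h2, mul_comm p, BB_X_mul, pderiv_TT, map_smul]

theorem eval_adj [CharZero F] {q t : F} (hq : ∀ n : ℕ, 1 - q ^ (n + 1) ≠ 0)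
    (ht : ∀ n : ℕ, 1 - t ^ (n + 1) ≠ 0) (φ : ℕ → F) (g f S : Sym F)
    (hS : ∀ h, BB q t S h = BB q t f (g * h)) :
    MvPolynomial.eval φ S = BB q t g (TT φ f) := by
  obtain ⟨S', h1, h2⟩ := exists_adj q t φ g f
  rw [← h2]
  congr 1
  apply BB_nondeg hq ht
  intro d
  rw [hS, h1]

theorem pairing_mul (q t : F) (φ : ℕ → F) (K : MvPowerSeries ℕ F)
    (hK : ∀ f, pairing q t K f = MvPolynomial.eval φ f) (g : Sym F) : ∀ f : Sym F,
    pairing q t ((g : MvPowerSeries ℕ F) * K) f = BB q t g (TT φ f) := by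
  induction g using MvPolynomial.induction_on with
  | C a =>
    intro f
    rw [MvPolynomial.coe_C, ← MvPowerSeries.smul_eq_C_mul, pairing_smul, hK, BB_C,
      constantCoeff_TT]
  | add p r hp hr =>
    intro f
    rw [MvPolynomial.coe_add, add_mul, pairing_add, hp, hr, map_add, LinearMap.add_apply]
  | mul_X p n hp =>
    intro f
    rw [mul_comm p, MvPolynomial.coe_mul, MvPolynomial.coe_X, mul_assoc, pairing_X_mul, hp,
      BB_X_mul, pderiv_TT, map_smul, smul_eq_mul]

theorem prodSeries_coeff (a b q : F) (d : ℕ →₀ ℕ) :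
    MvPowerSeries.coeff d (prodSeries a b q) =
      (d.prod fun n m => ((n : F) + 1) ^ m * (Nat.factorial m : F))⁻¹ *
        d.prod (fun n m => ((a ^ (n + 1) - b ^ (n + 1)) / (1 - q ^ (n + 1))) ^ m) := by
  obtain ⟨k, rfl⟩ := expo_surjective d
  change MvPolynomial.coeff (expo k) (prodComp a b q (wt (expo k))) = _
  unfold prodComp
  rw [finsum_size, MvPolynomial.coeff_sum, Finset.sum_eq_single k]
  · rw [pprod_eq, MvPolynomial.coeff_smul, MvPolynomial.coeff_monomial, if_pos rfl, smul_eq_mul,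
      mul_one, zee_eq, expo_prod]
    congr 1
    refine Finset.prod_congr rfl fun j hj => ?_
    have : k.part j ≠ 0 := by simpa using hj
    rw [Nat.sub_add_cancel (by omega)]
  · intro l _ hl
    rw [pprod_eq, MvPolynomial.coeff_smul, MvPolynomial.coeff_monomial, if_neg, smul_zero]
    exact fun h => hl (expo_injective h)
  · intro h
    exact absurd (by simp [sizeFin, wt_expo]) h

theorem pairing_prodSeries [CharZero F] {q t : F} (hq : ∀ n : ℕ, 1 - q ^ (n + 1) ≠ 0)
    (ht : ∀ n : ℕ, 1 - t ^ (n + 1) ≠ 0) (a b : F) (f : Sym F) :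
    pairing q t (prodSeries a b q) f =
      MvPolynomial.eval (fun n => (a ^ (n + 1) - b ^ (n + 1)) / (1 - t ^ (n + 1))) f := by
  induction f using MvPolynomial.induction_on' with
  | monomial d c =>
    rw [pairing_monomial, MvPolynomial.eval_monomial, prodSeries_coeff]
    congr 1
    unfold ww Finsupp.prod
    rw [← Finset.prod_inv_distrib, ← Finset.prod_mul_distrib, ← Finset.prod_mul_distrib]
    refine Finset.prod_congr rfl fun n _ => ?_
    have h1 : (n : F) + 1 ≠ 0 := Nat.cast_add_one_ne_zero n
    have h2 : ((d n).factorial : F) ≠ 0 := Nat.cast_ne_zero.2 (Nat.factorial_ne_zero _)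
    have h3 := hq n
    have h4 := ht n
    have h5 : (a ^ (n + 1) - b ^ (n + 1)) / (1 - t ^ (n + 1)) =
      ((a ^ (n + 1) - b ^ (n + 1)) / (1 - q ^ (n + 1))) * ((1 - q ^ (n + 1)) / (1 - t ^ (n + 1))) := by
      field_simp
    change ((↑n + 1) ^ d n * ((d n).factorial : F))⁻¹ *
        ((a ^ (n + 1) - b ^ (n + 1)) / (1 - q ^ (n + 1))) ^ d n *
      ((↑n + 1) ^ d n * ((d n).factorial : F) * ((1 - q ^ (n + 1)) / (1 - t ^ (n + 1))) ^ d n) =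
      ((a ^ (n + 1) - b ^ (n + 1)) / (1 - t ^ (n + 1))) ^ d n
    rw [h5, mul_pow]
    have h6 : (↑n + 1) ^ d n * ((d n).factorial : F) ≠ 0 := mul_ne_zero (pow_ne_zero _ h1) h2
    generalize (↑n + 1) ^ d n * ((d n).factorial : F) = z at *
    generalize (a ^ (n + 1) - b ^ (n + 1)) / (1 - q ^ (n + 1)) = x at *
    rw [show z⁻¹ * x ^ d n * (z * ((1 - q ^ (n + 1)) / (1 - t ^ (n + 1))) ^ d n) =
      (z⁻¹ * z) * (x ^ d n * ((1 - q ^ (n + 1)) / (1 - t ^ (n + 1))) ^ d n) by ring,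
      inv_mul_cancel₀ h6, one_mul]
  | add p q hp hq => simp only [map_add, hp, hq]

/-! ### Complete symmetric functions span -/

/-- products of complete symmetric functions, indexed by exponent vectors -/
def hh (F : Type*) [Field F] (d : ℕ →₀ ℕ) : Sym F := d.prod fun n m => hsym F (n + 1) ^ m

theorem hprod_eq (k : Partition) : hprod F k = hh F (expo k) := by
  unfold hprod hh
  rw [expo_prod k (fun n => hsym F (n + 1))]
  refine Finset.prod_congr rfl fun j hj => ?_
  have : k.part j ≠ 0 := by simpa using hj
  rw [Nat.sub_add_cancel (by omega)]

theorem hh_add (d e : ℕ →₀ ℕ) : hh F (d + e) = hh F d * hh F e := by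
  unfold hh
  rw [Finsupp.prod_add_index'] <;> intros
  · simp
  · exact pow_add _ _ _

/-- span of the `h_d` of weight `n` -/
def WW (F : Type*) [Field F] (n : ℕ) : Submodule F (Sym F) :=
  Submodule.span F {x | ∃ d, wt d = n ∧ x = hh F d}

theorem WW_one : (1 : Sym F) ∈ WW F 0 :=
  Submodule.subset_span ⟨0, wt_zero, by simp [hh]⟩

theorem WW_mul {m n : ℕ} {x y : Sym F} (hx : x ∈ WW F m) (hy : y ∈ WW F n) :
    x * y ∈ WW F (m + n) := by
  unfold WW at hx
  induction hx using Submodule.span_induction with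
  | mem x hx =>
    obtain ⟨d, hd, rfl⟩ := hx
    unfold WW at hy
    induction hy using Submodule.span_induction with
    | mem y hy =>
      obtain ⟨e, he, rfl⟩ := hy
      exact Submodule.subset_span ⟨d + e, by rw [wt_add, hd, he], (hh_add d e).symm⟩
    | zero => rw [mul_zero]; exact Submodule.zero_mem _
    | add a b _ _ ha hb => rw [mul_add]; exact Submodule.add_mem _ ha hb
    | smul c a _ ha => rw [mul_smul_comm]; exact Submodule.smul_mem _ _ ha
  | zero => rw [zero_mul]; exact Submodule.zero_mem _
  | add a b _ _ ha hb => rw [add_mul]; exact Submodule.add_mem _ ha hb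
  | smul c a _ ha => rw [smul_mul_assoc]; exact Submodule.smul_mem _ _ ha

theorem WW_pow {m : ℕ} {x : Sym F} (hx : x ∈ WW F m) (n : ℕ) : x ^ n ∈ WW F (m * n) := by
  induction n with
  | zero => simpa using WW_one
  | succ n ih => rw [pow_succ, mul_add, mul_one]; exact WW_mul ih hx

theorem WW_monomial (d : ℕ →₀ ℕ)
    (h : ∀ i ∈ d.support, (MvPolynomial.X i : Sym F) ∈ WW F (i + 1)) :
    (MvPolynomial.monomial d 1 : Sym F) ∈ WW F (wt d) := by
  rw [MvPolynomial.monomial_eq, map_one, one_mul]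
  unfold wt Finsupp.prod Finsupp.sum
  have key : ∀ s : Finset ℕ, s ⊆ d.support →
      (∏ i ∈ s, (MvPolynomial.X i : Sym F) ^ d i) ∈ WW F (∑ i ∈ s, (i + 1) * d i) := by
    intro s
    induction s using Finset.cons_induction with
    | empty => intro _; simpa using WW_one
    | cons a s ha ih =>
      intro hs
      rw [Finset.prod_cons, Finset.sum_cons]
      exact WW_mul (WW_pow (h a (hs (Finset.mem_cons_self a s))) _)
        (ih fun x hx => hs (Finset.mem_cons_of_mem hx))
  exact key _ (Finset.Subset.refl _)

theorem wt_eq_zero {d : ℕ →₀ ℕ} (h : wt d = 0) : d = 0 := by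
  ext i
  have := le_wt d i
  rw [h] at this
  simpa using this

theorem lt_of_wt {n : ℕ} {d : ℕ →₀ ℕ} (h : wt d = n + 1) (hne : d ≠ Finsupp.single n 1) :
    ∀ i ∈ d.support, i < n := by
  intro i hi
  have h1 := le_wt d i
  have h2 : 1 ≤ d i := Nat.one_le_iff_ne_zero.2 (by simpa using hi)
  have h3 : i ≤ n := by nlinarith
  rcases h3.lt_or_eq with h4 | h4
  · exact h4
  · exfalso
    subst h4
    apply hne
    have h5 := Finsupp.single_add_erase i d
    have h6 : wt d = (i + 1) * d i + wt (Finsupp.erase i d) := by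
      conv_lhs => rw [← h5]
      rw [wt_add, wt_single]
    have h7 : d i = 1 := by nlinarith
    rw [h7] at h6
    have h8 : Finsupp.erase i d = 0 := wt_eq_zero (by omega)
    rw [← h5, h7, h8, add_zero]

theorem WW_X [CharZero F] (n : ℕ) : (MvPolynomial.X n : Sym F) ∈ WW F (n + 1) := by
  induction n using Nat.strong_induction_on with
  | _ n ih =>
    obtain ⟨k, hk⟩ := expo_surjective (Finsupp.single n 1)
    have hh1 : hsym F (n + 1) ∈ WW F (n + 1) :=
      Submodule.subset_span ⟨Finsupp.single n 1, by rw [wt_single, mul_one], by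
        unfold hh; rw [Finsupp.prod_single_index] <;> simp⟩
    have hkm : k ∈ sizeFin (n + 1) := by
      simp [sizeFin, ← wt_expo, hk, wt_single]
    unfold hsym at hh1
    classical
    rw [finsum_size, ← Finset.add_sum_erase _ _ hkm] at hh1
    have h2 : ∑ x ∈ (sizeFin (n + 1)).erase k, ((x.zee : F))⁻¹ • (pprod x : Sym F)
        ∈ WW F (n + 1) := by
      refine Submodule.sum_mem _ fun x hx => Submodule.smul_mem _ _ ?_
      rw [Finset.mem_erase] at hx
      have hx2 : wt (expo x) = n + 1 := by
        have := hx.2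
        simpa [sizeFin, wt_expo] using this
      rw [pprod_eq, ← hx2]
      apply WW_monomial
      intro i hi
      exact ih i (lt_of_wt hx2 (fun h => hx.1 (expo_injective (h.trans hk.symm))) i hi)
    have h3 := (Submodule.add_mem_iff_left _ h2).1 hh1
    rw [pprod_eq, hk] at h3
    have hz : (k.zee : F) ≠ 0 := by
      rw [zee_eq, hk, Finsupp.prod_single_index (by simp)]
      simpa using Nat.cast_add_one_ne_zero n
    exact (Submodule.smul_mem_iff _ (inv_ne_zero hz)).1 h3

theorem WW_all [CharZero F] (d : ℕ →₀ ℕ) :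
    (MvPolynomial.monomial d 1 : Sym F) ∈ WW F (wt d) :=
  WW_monomial d fun i _ => WW_X i

/-! ### The Macdonald polynomials form an orthogonal basis -/

theorem mac_coeff [CharZero F] {q t : F} (ht : ∀ n : ℕ, 1 - t ^ (n + 1) ≠ 0)
    {P : Partition → Sym F} (hP : IsMacdonald q t P) (lam : Partition) (d : ℕ →₀ ℕ)
    (hd : wt d ≠ lam.size) : MvPolynomial.coeff d (P lam) = 0 := by
  have h : ∀ x ∈ WW F (wt d), BB t t (P lam) x = 0 := by
    intro x hx
    unfold WW at hx
    induction hx using Submodule.span_induction with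
    | mem x hx =>
      obtain ⟨e, he, rfl⟩ := hx
      obtain ⟨k, rfl⟩ := expo_surjective e
      rw [← hprod_eq, ← innerQT_eq]
      apply hP.2.2
      intro hdom
      exact hd (by rw [← he, wt_expo, hdom.1])
    | zero => simp
    | add a b _ _ ha hb => rw [map_add, ha, hb, add_zero]
    | smul c a _ ha => rw [map_smul, ha, smul_zero]
  have h2 := h _ (WW_all d)
  rw [BB_monomial, one_mul] at h2
  exact (mul_eq_zero.1 h2).resolve_right (ww_ne_zero ht ht d)

theorem psum_injective {k l : Partition} (h : k.psum = l.psum) : k = l := by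
  apply Partition.ext_part
  intro j
  have h1 := congrFun h j
  have h2 := congrFun h (j + 1)
  simp only [Partition.psum, Finset.sum_range_succ] at h1 h2
  omega

theorem mac_linearIndependent {q t : F} {P : Partition → Sym F} (hP : IsMacdonald q t P) :
    LinearIndependent F P := by
  classical
  rw [linearIndependent_iff']
  intro s g hg
  by_contra hcon
  push Not at hcon
  obtain ⟨i, his, hgi⟩ := hcon
  obtain ⟨m, hm⟩ := (s.filter fun k => g k ≠ 0).exists_maximalFor Partition.psum
    ⟨i, by simp [his, hgi]⟩
  have hms : m ∈ s ∧ g m ≠ 0 := by simpa using hm.1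
  have h1 : BB t t (∑ k ∈ s, g k • P k) (hprod F m) = g m := by
    rw [map_sum, LinearMap.sum_apply, Finset.sum_eq_single m]
    · rw [map_smul, LinearMap.smul_apply, ← innerQT_eq, hP.2.1, smul_eq_mul, mul_one]
    · intro k hk hkm
      rw [map_smul, LinearMap.smul_apply, ← innerQT_eq, smul_eq_mul]
      by_cases hgk : g k = 0
      · rw [hgk, zero_mul]
      · rw [hP.2.2, mul_zero]
        intro hdom
        have hle : m.psum ≤ k.psum := fun j => hdom.2 j
        exact hkm (psum_injective (le_antisymm (hm.2 (by simp [hk, hgk]) hle) hle))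
    · intro h; exact absurd hms.1 h
  rw [hg] at h1
  simp at h1
  exact hms.2 h1.symm

theorem mac_span [CharZero F] {q t : F} (ht : ∀ n : ℕ, 1 - t ^ (n + 1) ≠ 0)
    {P : Partition → Sym F} (hP : IsMacdonald q t P) (f : Sym F) :
    f ∈ Submodule.span F (Set.range P) := by
  have key : ∀ d : ℕ →₀ ℕ, (MvPolynomial.monomial d 1 : Sym F) ∈
      Submodule.span F (Set.range P) := by
    intro d
    have : Fintype {k : Partition // k.size = wt d} := (size_finite (wt d)).fintype
    have : Fintype {e : ℕ →₀ ℕ // wt e = wt d} := (wt_finite (wt d)).fintype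
    let b1 : {k : Partition // k.size = wt d} → Sym F := fun k => P k.1
    let b2 : {e : ℕ →₀ ℕ // wt e = wt d} → Sym F := fun e => MvPolynomial.monomial e.1 1
    have l1 : LinearIndependent F b1 :=
      (mac_linearIndependent hP).comp _ Subtype.val_injective
    have l2 : LinearIndependent F b2 := by
      have := (MvPolynomial.basisMonomials ℕ F).linearIndependent.comp
        (fun e : {e : ℕ →₀ ℕ // wt e = wt d} => e.1) Subtype.val_injective
      rw [MvPolynomial.coe_basisMonomials] at this
      exact this
    have hcard : Fintype.card {k : Partition // k.size = wt d} =
        Fintype.card {e : ℕ →₀ ℕ // wt e = wt d} :=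
      Fintype.card_congr (expoEquiv.subtypeEquiv fun k => by rw [expoEquiv_apply, wt_expo])
    have hle : Submodule.span F (Set.range b1) ≤ Submodule.span F (Set.range b2) := by
      rw [Submodule.span_le]
      rintro _ ⟨k, rfl⟩
      change P k.1 ∈ Submodule.span F (Set.range b2)
      rw [(P k.1).as_sum]
      refine Submodule.sum_mem _ fun e he => ?_
      have hwe : wt e = wt d := by
        by_contra hne
        rw [MvPolynomial.mem_support_iff] at he
        exact he (mac_coeff ht hP k.1 e (by rw [k.2]; exact hne))
      rw [← mul_one (MvPolynomial.coeff e (P k.1)), ← smul_eq_mul, ← MvPolynomial.smul_monomial]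
      exact Submodule.smul_mem _ _ (Submodule.subset_span ⟨⟨e, hwe⟩, rfl⟩)
    have : FiniteDimensional F (Submodule.span F (Set.range b2)) :=
      FiniteDimensional.span_of_finite F (Set.finite_range b2)
    have heq := Submodule.eq_of_le_of_finrank_eq hle (by
      rw [finrank_span_eq_card l1, finrank_span_eq_card l2, hcard])
    have hmem : (MvPolynomial.monomial d 1 : Sym F) ∈ Submodule.span F (Set.range b1) := by
      rw [heq]
      exact Submodule.subset_span ⟨⟨d, rfl⟩, rfl⟩
    refine Submodule.span_mono ?_ hmem
    rintro _ ⟨k, rfl⟩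
    exact ⟨k.1, rfl⟩
  rw [f.as_sum]
  refine Submodule.sum_mem _ fun e _ => ?_
  rw [← mul_one (MvPolynomial.coeff e f), ← smul_eq_mul, ← MvPolynomial.smul_monomial]
  exact Submodule.smul_mem _ _ (key e)

theorem mac_orth {q t : F} {P : Partition → Sym F} (hP : IsMacdonald q t P) {k l : Partition}
    (h : k ≠ l) : BB q t (P k) (P l) = 0 := by
  rw [← innerQT_eq]; exact hP.1 k l h

theorem mac_norm [CharZero F] {q t : F} (hq : ∀ n : ℕ, 1 - q ^ (n + 1) ≠ 0)
    (ht : ∀ n : ℕ, 1 - t ^ (n + 1) ≠ 0)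
    {P : Partition → Sym F} (hP : IsMacdonald q t P) (k : Partition) :
    BB q t (P k) (P k) ≠ 0 := by
  intro h0
  have hall : ∀ f, BB q t (P k) f = 0 := by
    intro f
    have hf := mac_span ht hP f
    induction hf using Submodule.span_induction with
    | mem x hx =>
      obtain ⟨l, rfl⟩ := hx
      by_cases h : k = l
      · subst h; exact h0
      · exact mac_orth hP h
    | zero => simp
    | add a b _ _ ha hb => rw [map_add, ha, hb, add_zero]
    | smul c a _ ha => rw [map_smul, ha, smul_zero]
  have hz : P k = 0 := BB_nondeg hq ht _ _ fun d => by rw [hall]; simp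
  have h1 := hP.2.1 k
  rw [hz, innerQT_eq] at h1
  simp at h1

theorem macQ_eq (q t : F) (P : Partition → Sym F) (k : Partition) :
    macQ q t P k = (BB q t (P k) (P k))⁻¹ • P k := by
  unfold macQ bnorm; rw [innerQT_eq]

theorem mac_expand [CharZero F] {q t : F} (hq : ∀ n : ℕ, 1 - q ^ (n + 1) ≠ 0)
    (ht : ∀ n : ℕ, 1 - t ^ (n + 1) ≠ 0)
    {P : Partition → Sym F} (hP : IsMacdonald q t P) (f : Sym F) :
    ∃ A : Finset Partition, (∀ k, BB q t (P k) f ≠ 0 → k ∈ A) ∧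
      ∀ L : Finset Partition, A ⊆ L → ∑ k ∈ L, BB q t (P k) f • macQ q t P k = f := by
  obtain ⟨c, hc⟩ := Finsupp.mem_span_range_iff_exists_finsupp.1 (mac_span ht hP f)
  have hco : ∀ k, BB q t (P k) f = c k * BB q t (P k) (P k) := by
    intro k
    rw [← hc, Finsupp.sum, map_sum, Finset.sum_eq_single k]
    · rw [map_smul, smul_eq_mul]
    · intro l _ hl
      rw [map_smul, mac_orth hP (Ne.symm hl), smul_zero]
    · intro hk
      have : c k = 0 := by simpa using hk
      rw [this]; simp
  refine ⟨c.support, fun k hk => ?_, fun L hL => ?_⟩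
  · rw [Finsupp.mem_support_iff]
    intro h0
    exact hk (by rw [hco, h0, zero_mul])
  · rw [← hc]
    rw [Finsupp.sum_of_support_subset c hL _ (by simp)]
    refine Finset.sum_congr rfl fun k _ => ?_
    have hs : ∑ i ∈ L, c i • P i = f := by
      rw [← hc, Finsupp.sum_of_support_subset c hL _ (by simp)]
    rw [hs, hco, macQ_eq, smul_smul, mul_assoc, mul_inv_cancel₀ (mac_norm hq ht hP k), mul_one]

theorem skewQ_adj [CharZero F] {q t : F} (hq : ∀ n : ℕ, 1 - q ^ (n + 1) ≠ 0)
    (ht : ∀ n : ℕ, 1 - t ^ (n + 1) ≠ 0)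
    {P : Partition → Sym F} (hP : IsMacdonald q t P) (lam mu : Partition) (h : Sym F) :
    BB q t (skewQ q t P lam mu) h = BB q t (macQ q t P lam) (P mu * h) := by
  obtain ⟨S, hS, -⟩ := exists_adj q t 0 (P mu) (macQ q t P lam)
  obtain ⟨A, hA, hL⟩ := mac_expand hq ht hP S
  rw [← hS]
  congr 2
  conv_rhs => rw [← hL A (Finset.Subset.refl _)]
  unfold skewQ
  have : ∀ nu, innerQT q t (macQ q t P lam) (P mu * P nu) • macQ q t P nu =
      BB q t (P nu) S • macQ q t P nu := by
    intro nu
    rw [innerQT_eq, ← hS, BB_symm]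
  simp only [this]
  apply finsum_eq_sum_of_support_subset
  intro nu hnu
  apply hA
  intro h0
  exact hnu (by simp [h0])

theorem skewP_adj [CharZero F] {q t : F} (hq : ∀ n : ℕ, 1 - q ^ (n + 1) ≠ 0)
    (ht : ∀ n : ℕ, 1 - t ^ (n + 1) ≠ 0)
    {P : Partition → Sym F} (hP : IsMacdonald q t P) (lam mu : Partition) (h : Sym F) :
    BB q t (skewP q t P lam mu) h = BB q t (P lam) (macQ q t P mu * h) := by
  obtain ⟨S, hS, -⟩ := exists_adj q t 0 (macQ q t P mu) (P lam)
  obtain ⟨A, hA, hL⟩ := mac_expand hq ht hP S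
  rw [← hS]
  congr 2
  conv_rhs => rw [← hL A (Finset.Subset.refl _)]
  unfold skewP
  have : ∀ nu, innerQT q t (P lam) (macQ q t P mu * macQ q t P nu) • P nu =
      BB q t (P nu) S • macQ q t P nu := by
    intro nu
    rw [innerQT_eq, ← hS, BB_symm, macQ_eq, smul_smul, map_smul, LinearMap.smul_apply,
      smul_eq_mul, mul_comm]
  simp only [this]
  apply finsum_eq_sum_of_support_subset
  intro nu hnu
  apply hA
  intro h0
  exact hnu (by simp [h0])

theorem pleth_skewQ [CharZero F] {q t : F} (hq : ∀ n : ℕ, 1 - q ^ (n + 1) ≠ 0)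
    (ht : ∀ n : ℕ, 1 - t ^ (n + 1) ≠ 0)
    {P : Partition → Sym F} (hP : IsMacdonald q t P) (lam mu : Partition) (φ : ℕ → F) :
    MvPolynomial.eval φ (skewQ q t P lam mu) = BB q t (P mu) (TT φ (macQ q t P lam)) :=
  eval_adj hq ht φ _ _ _ (skewQ_adj hq ht hP lam mu)

theorem qbinomial_general [CharZero F] {q t : F} (hq : ∀ n : ℕ, 1 - q ^ (n + 1) ≠ 0)
    (ht : ∀ n : ℕ, 1 - t ^ (n + 1) ≠ 0) (a b : F)
    {P : Partition → Sym F} (hP : IsMacdonald q t P) (mu nu : Partition) :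
    sumSeries
        (fun p : Partition × Partition =>
          plethAB t a b (skewQ q t P nu p.2) * plethAB t b a (skewQ q t P p.1 mu))
        (fun p => skewP q t P p.1 p.2) =
      (skewP q t P mu nu : MvPowerSeries ℕ F) * prodSeries b a q := by
  classical
  let φ : ℕ → F := fun n => (a ^ (n + 1) - b ^ (n + 1)) / (1 - t ^ (n + 1))
  let ψ : ℕ → F := fun n => (b ^ (n + 1) - a ^ (n + 1)) / (1 - t ^ (n + 1))
  have hφψ : ∀ n, φ n + ψ n = 0 := fun n => by
    change (a ^ (n + 1) - b ^ (n + 1)) / (1 - t ^ (n + 1)) +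
      (b ^ (n + 1) - a ^ (n + 1)) / (1 - t ^ (n + 1)) = 0
    ring
  have hφ : ∀ eta, plethAB t a b (skewQ q t P nu eta) =
      BB q t (P eta) (TT φ (macQ q t P nu)) := fun eta => pleth_skewQ hq ht hP nu eta φ
  have hψ : ∀ lam, plethAB t b a (skewQ q t P lam mu) =
      BB q t (P mu) (TT ψ (macQ q t P lam)) := fun lam => pleth_skewQ hq ht hP lam mu ψ
  simp only [hφ, hψ]
  ext d
  apply mul_right_cancel₀ (ww_ne_zero hq ht d)
  let f : Sym F := MvPolynomial.monomial d 1
  have hR : MvPowerSeries.coeff d ((skewP q t P mu nu : MvPowerSeries ℕ F) * prodSeries b a q) *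
      ww q t d = BB q t (P mu) (macQ q t P nu * TT ψ f) := by
    have h1 := pairing_mul q t ψ (prodSeries b a q) (pairing_prodSeries hq ht b a)
      (skewP q t P mu nu) f
    rw [pairing_monomial, one_mul] at h1
    rw [h1, skewP_adj hq ht hP]
  rw [hR]
  obtain ⟨A, hA, hAL⟩ := mac_expand hq ht hP (TT φ (macQ q t P nu))
  choose C hC hCL using fun eta => mac_expand hq ht hP (macQ q t P eta * f)
  let L := A.biUnion C
  have hterm : ∀ p : Partition × Partition, MvPolynomial.coeff d (skewP q t P p.1 p.2) * ww q t d =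
      BB q t (P p.1) (macQ q t P p.2 * f) := by
    intro p
    rw [← skewP_adj hq ht hP, BB_monomial, one_mul]
  have hw := ww_ne_zero hq ht d
  have hL : MvPowerSeries.coeff d (sumSeries
        (fun p : Partition × Partition =>
          BB q t (P p.2) (TT φ (macQ q t P nu)) * BB q t (P mu) (TT ψ (macQ q t P p.1)))
        (fun p => skewP q t P p.1 p.2)) =
      ∑ p ∈ L ×ˢ A, BB q t (P p.2) (TT φ (macQ q t P nu)) *
        BB q t (P mu) (TT ψ (macQ q t P p.1)) * MvPolynomial.coeff d (skewP q t P p.1 p.2) := by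
    change ∑ᶠ p : Partition × Partition, _ = _
    apply finsum_eq_sum_of_support_subset
    intro p hp
    rw [Function.mem_support] at hp
    have h1 := left_ne_zero_of_mul (left_ne_zero_of_mul hp)
    have h2 := right_ne_zero_of_mul hp
    have h3 : p.2 ∈ A := hA _ h1
    have h4 : p.1 ∈ C p.2 := hC _ _ (by rw [← hterm]; exact mul_ne_zero h2 hw)
    rw [Finset.mem_coe, Finset.mem_product]
    exact ⟨Finset.mem_biUnion.2 ⟨p.2, h3, h4⟩, h3⟩
  rw [hL, Finset.sum_mul, Finset.sum_product_right]
  have hin : ∀ eta ∈ A, ∑ lam ∈ L, BB q t (P eta) (TT φ (macQ q t P nu)) *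
        BB q t (P mu) (TT ψ (macQ q t P lam)) * MvPolynomial.coeff d (skewP q t P lam eta) *
        ww q t d =
      BB q t (P mu) (TT ψ ((BB q t (P eta) (TT φ (macQ q t P nu)) • macQ q t P eta) * f)) := by
    intro eta heta
    rw [smul_mul_assoc, ← hCL eta L (Finset.subset_biUnion_of_mem C heta), map_smul, map_smul,
      map_sum, map_sum, smul_eq_mul, Finset.mul_sum]
    refine Finset.sum_congr rfl fun lam _ => ?_
    have := hterm (lam, eta)
    simp only at this
    rw [mul_assoc, this, map_smul, map_smul, smul_eq_mul]
    ring
  rw [Finset.sum_congr rfl hin, ← map_sum, ← map_sum, ← Finset.sum_mul,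
    hAL A (Finset.Subset.refl _), map_mul, TT_inv φ ψ hφψ]

theorem one_sub_pow_ne {K : Type*} [Field K] (n : ℕ) : (1 : RatFunc K) - RatFunc.X ^ (n + 1) ≠ 0 := by
  intro h
  have h1 : (RatFunc.X : RatFunc K) ^ (n + 1) = 1 := (sub_eq_zero.1 h).symm
  rw [← RatFunc.algebraMap_X, ← map_pow, ← map_one (algebraMap (Polynomial K) (RatFunc K))] at h1
  have h2 := RatFunc.algebraMap_injective K h1
  have h3 := congrArg Polynomial.natDegree h2
  simp at h3

theorem one_sub_C_pow_ne {K : Type*} [Field K] (x : K) (n : ℕ) (h : 1 - x ^ (n + 1) ≠ 0) :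
    (1 : RatFunc K) - (RatFunc.C x) ^ (n + 1) ≠ 0 := by
  rw [← map_pow, ← map_one RatFunc.C, ← map_sub]
  exact (map_ne_zero _).2 h

theorem charZero_ratFunc (K : Type*) [Field K] [CharZero K] : CharZero (RatFunc K) :=
  charZero_of_injective_algebraMap (algebraMap K (RatFunc K)).injective

/-- Dual form of the `q`-binomial theorem for Macdonald
polynomials: for all partitions `μ, ν` and parameters `a, b`,
`∑_{λ,η} Q_{ν/η}((a-b)/(1-t)) Q_{λ/μ}((b-a)/(1-t)) P_{λ/η}(X;q,t)
  = P_{μ/ν}(X;q,t) ∏_{x ∈ X} (ax;q)_∞/(bx;q)_∞`,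
as an identity of symmetric formal power series, the sum over all pairs of
partitions `(λ,η)`. -/
theorem qbinomial_theorem_macdonald_dual
    (P : Partition → Sym F4) (hP : IsMacdonald q4 t4 P) (mu nu : Partition) :
    sumSeries
        (fun p : Partition × Partition =>
          plethAB t4 a4 b4 (skewQ q4 t4 P nu p.2) * plethAB t4 b4 a4 (skewQ q4 t4 P p.1 mu))
        (fun p => skewP q4 t4 P p.1 p.2) =
      (skewP q4 t4 P mu nu : MvPowerSeries ℕ F4) * prodSeries b4 a4 q4 := by
  have : CharZero F1 := charZero_ratFunc ℚ
  have : CharZero F2 := charZero_ratFunc F1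
  have : CharZero F3 := charZero_ratFunc F2
  have : CharZero F4 := charZero_ratFunc F3
  refine qbinomial_general (fun n => ?_) (fun n => ?_) a4 b4 hP mu nu
  · exact one_sub_C_pow_ne _ _ (one_sub_C_pow_ne _ _ (one_sub_pow_ne n))
  · exact one_sub_C_pow_ne _ _ (one_sub_C_pow_ne _ _ (one_sub_C_pow_ne _ _ (one_sub_pow_ne n)))

end SkewPieriFormalization
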